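/- Two non-degenerate quadratic forms q₁, q₂ over ℚ of the same rank become isomorphic over ℚ_p if and only if their discriminants coincide in ℚ_p×/(ℚ_p×)² and their Hasse invariants at p coincide. -/

import Mathlib

noncomputable section

open Classical in
/-- The Hilbert symbol over a field `K`: it is `1` if the conic
`z² = a x² + b y²` has a nontrivial solution over `K`, and `-1` otherwise. -/
def hilbertSym (K : Type*) [Field K] (a b : K) : ℤ :=
  if ∃ x y z : K, (x, y, z) ≠ (0, 0, 0) ∧ z ^ 2 = a * x ^ 2 + b * y ^ 2 then 1 else -1

/-- The Hasse–Witt invariant `ε(q) = ∏_{i<j} (a_i, a_j)` of the diagonal quadratic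
form `⟨a 0, …, a (n-1)⟩` over `K`. -/
def hasseInv (K : Type*) [Field K] {n : ℕ} (a : Fin n → K) : ℤ :=
  ∏ i : Fin n, ∏ j : Fin n, if i < j then hilbertSym K (a i) (a j) else 1

/-- `b` is a value of the norm form `x² - a y²`. -/
def IsQuadNorm {K : Type*} [Field K] (a b : K) : Prop :=
  ∃ x y : K, b = x ^ 2 - a * y ^ 2

section IsQuadNorm

variable {K : Type*} [Field K] {a b c : K}

theorem IsQuadNorm.mul (hb : IsQuadNorm a b) (hc : IsQuadNorm a c) : IsQuadNorm a (b * c) := by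
  obtain ⟨x, y, rfl⟩ := hb
  obtain ⟨z, w, rfl⟩ := hc
  exact ⟨x * z + a * y * w, x * w + y * z, by ring⟩

theorem isQuadNorm_sq (a s : K) : IsQuadNorm a (s ^ 2) := ⟨s, 0, by ring⟩

theorem isQuadNorm_neg_self (a : K) : IsQuadNorm a (-a) := ⟨0, 1, by ring⟩

theorem isQuadNorm_mul_sq_iff {s : K} (hs : s ≠ 0) :
    IsQuadNorm a (b * s ^ 2) ↔ IsQuadNorm a b := by
  refine ⟨fun ⟨x, y, h⟩ => ⟨x / s, y / s, ?_⟩, fun h => h.mul (isQuadNorm_sq a s)⟩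
  field_simp
  exact h

theorem isQuadNorm_left_mul_sq_iff {s : K} (hs : s ≠ 0) :
    IsQuadNorm (a * s ^ 2) b ↔ IsQuadNorm a b := by
  constructor
  · rintro ⟨x, y, h⟩
    exact ⟨x, s * y, by rw [h]; ring⟩
  · rintro ⟨x, y, h⟩
    exact ⟨x, y / s, by rw [h]; field_simp⟩

/-- The norm group of `x² - a y²` has index two in `Kˣ`. -/
def QuadNormIndexTwo (a : K) : Prop :=
  ∃ w : K, w ≠ 0 ∧ ¬ IsQuadNorm a w ∧ ∀ b : K, b ≠ 0 → IsQuadNorm a b ∨ IsQuadNorm a (w * b)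

theorem QuadNormIndexTwo.mul_sq {s : K} (hs : s ≠ 0) (h : QuadNormIndexTwo a) :
    QuadNormIndexTwo (a * s ^ 2) := by
  simpa only [QuadNormIndexTwo, isQuadNorm_left_mul_sq_iff hs] using h

end IsQuadNorm

namespace Padic

variable {p : ℕ} [Fact p.Prime]

/-- A criterion for `w` not to be a value of `x² - a y²`: every integral solution of
`w z² = x² - a y²` is imprimitive. -/
theorem not_isQuadNorm_of_imprimitive {a w : ℤ_[p]}
    (h : ∀ x y z : ℤ_[p], w * z ^ 2 = x ^ 2 - a * y ^ 2 →
      (p : ℤ_[p]) ∣ x ∧ (p : ℤ_[p]) ∣ y ∧ (p : ℤ_[p]) ∣ z) :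
    ¬ IsQuadNorm (a : ℚ_[p]) (w : ℚ_[p]) := by
  rintro ⟨x, y, hxy⟩
  have hp1 : ¬ (p : ℤ_[p]) ∣ 1 := PadicInt.prime_p.not_dvd_one
  have key : ∀ t : ℚ_[p], t ≠ 0 → ∀ (hx : ‖x / t‖ ≤ 1) (hy : ‖y / t‖ ≤ 1) (hz : ‖1 / t‖ ≤ 1),
      (p : ℤ_[p]) ∣ ⟨x / t, hx⟩ ∧ (p : ℤ_[p]) ∣ ⟨y / t, hy⟩ ∧ (p : ℤ_[p]) ∣ ⟨1 / t, hz⟩ := by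
    intro t ht hx hy hz
    apply h
    apply Subtype.ext
    push_cast
    change (w : ℚ_[p]) * (1 / t) ^ 2 = (x / t) ^ 2 - a * (y / t) ^ 2
    rw [hxy]
    field_simp
  have hdiv : ∀ s t : ℚ_[p], t ≠ 0 → ‖s‖ ≤ ‖t‖ → ‖s / t‖ ≤ 1 := by
    intro s t ht hst
    rw [norm_div]
    exact div_le_one_of_le₀ hst (norm_nonneg _)
  have hpos : ∀ t : ℚ_[p], t ≠ 0 → ∀ h : ‖t / t‖ ≤ 1, Subtype.mk (t / t) h = (1 : ℤ_[p]) := by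
    intro t ht h
    apply Subtype.ext
    rw [PadicInt.coe_one]
    exact div_self ht
  rcases le_total ‖x‖ ‖y‖ with hxy' | hxy'
  · rcases le_total ‖y‖ ‖(1 : ℚ_[p])‖ with h1 | h1
    · have := (key 1 one_ne_zero (hdiv _ _ one_ne_zero (hxy'.trans h1))
        (hdiv _ _ one_ne_zero h1) (hdiv _ _ one_ne_zero le_rfl)).2.2
      rw [hpos _ one_ne_zero] at this
      exact hp1 this
    · have hy0 : y ≠ 0 := by rintro rfl; simp at h1; linarith
      have := (key y hy0 (hdiv _ _ hy0 hxy') (hdiv _ _ hy0 le_rfl) (hdiv _ _ hy0 h1)).2.1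
      rw [hpos _ hy0] at this
      exact hp1 this
  · rcases le_total ‖x‖ ‖(1 : ℚ_[p])‖ with h1 | h1
    · have := (key 1 one_ne_zero (hdiv _ _ one_ne_zero h1)
        (hdiv _ _ one_ne_zero (hxy'.trans h1)) (hdiv _ _ one_ne_zero le_rfl)).2.2
      rw [hpos _ one_ne_zero] at this
      exact hp1 this
    · have hx0 : x ≠ 0 := by rintro rfl; simp at h1; linarith
      have := (key x hx0 (hdiv _ _ hx0 le_rfl) (hdiv _ _ hx0 hxy') (hdiv _ _ hx0 h1)).1
      rw [hpos _ hx0] at this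
      exact hp1 this

theorem exists_eq_mul_sq_of_norm_lt {r u x : ℤ_[p]} (h : ‖r * x ^ 2 - u‖ < ‖2 * r * x‖ ^ 2) :
    ∃ z : ℤ_[p], u = r * z ^ 2 := by
  have hd : (Polynomial.derivative (Polynomial.C r * Polynomial.X ^ 2 - Polynomial.C u)).aeval x
      = 2 * r * x := by
    simp; ring
  have := hensels_lemma (p := p) (R := ℤ_[p])
    (F := Polynomial.C r * Polynomial.X ^ 2 - Polynomial.C u) (a := x) (by
      rw [hd]; simpa using h)
  obtain ⟨z, hz, -⟩ := this
  exact ⟨z, by simpa [sub_eq_zero, eq_comm] using hz⟩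

theorem exists_unit_mul_sq (x : ℚ_[p]) (hx : x ≠ 0) :
    ∃ (u : ℤ_[p]ˣ) (s : ℚ_[p]), s ≠ 0 ∧
      (x = (u : ℤ_[p]) * s ^ 2 ∨ x = p * (u : ℤ_[p]) * s ^ 2) := by
  have hp0 : (p : ℚ_[p]) ≠ 0 := by exact_mod_cast (Fact.out : p.Prime).ne_zero
  have hn : ‖x / (p : ℚ_[p]) ^ x.valuation‖ = 1 := by
    rw [norm_div, norm_zpow, Padic.norm_eq_zpow_neg_valuation hx, Padic.norm_p, inv_zpow,
      zpow_neg, div_self]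
    have := (Fact.out : p.Prime).ne_zero
    positivity
  have hu := PadicInt.mkUnits_eq hn
  obtain ⟨k, hk | hk⟩ := Int.even_or_odd' x.valuation
  · refine ⟨PadicInt.mkUnits hn, (p : ℚ_[p]) ^ k, zpow_ne_zero _ hp0, Or.inl ?_⟩
    rw [hu, hk, ← zpow_natCast, ← zpow_mul, mul_comm k]
    field_simp
    norm_cast
  · refine ⟨PadicInt.mkUnits hn, (p : ℚ_[p]) ^ k, zpow_ne_zero _ hp0, Or.inr ?_⟩
    rw [hu, hk, ← zpow_natCast, ← zpow_mul, mul_comm k, zpow_add₀ hp0, zpow_one]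
    field_simp
    norm_cast

theorem norm_two_of_ne_two (hp : p ≠ 2) : ‖(2 : ℤ_[p])‖ = 1 := by
  have : ‖((2 : ℤ) : ℤ_[p])‖ = 1 := by
    apply le_antisymm (PadicInt.norm_le_one _)
    by_contra! h
    rw [PadicInt.norm_int_lt_one_iff_dvd] at h
    have h2 := (Nat.prime_dvd_prime_iff_eq (Fact.out : p.Prime) Nat.prime_two).1
      (by exact_mod_cast h)
    exact hp h2
  simpa using this

theorem toZMod_eq_zero_iff (x : ℤ_[p]) : PadicInt.toZMod x = 0 ↔ (p : ℤ_[p]) ∣ x := by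
  rw [← RingHom.mem_ker, PadicInt.ker_toZMod, PadicInt.maximalIdeal_eq_span_p,
    Ideal.mem_span_singleton]

theorem exists_sq_of_isSquare_toZMod (hp : p ≠ 2) (u : ℤ_[p]ˣ)
    (h : IsSquare (PadicInt.toZMod (u : ℤ_[p]))) : ∃ z : ℤ_[p], (u : ℤ_[p]) = z ^ 2 := by
  obtain ⟨t, ht⟩ := h
  obtain ⟨x, rfl⟩ := ZMod.ringHom_surjective (PadicInt.toZMod (p := p)) t
  have h1 : ‖x ^ 2 - u‖ < 1 := by
    rw [PadicInt.norm_lt_one_iff_dvd, ← toZMod_eq_zero_iff]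
    simp [ht, sq]
  have hx : ‖x‖ = 1 := by
    rw [← PadicInt.isUnit_iff]
    by_contra hx
    rw [PadicInt.not_isUnit_iff, PadicInt.norm_lt_one_iff_dvd, ← toZMod_eq_zero_iff] at hx
    rw [hx, mul_zero, toZMod_eq_zero_iff, ← PadicInt.norm_lt_one_iff_dvd,
      PadicInt.norm_units] at ht
    exact lt_irrefl _ ht
  obtain ⟨z, hz⟩ := exists_eq_mul_sq_of_norm_lt (r := 1) (u := u) (x := x) (by
    simpa [hx, norm_two_of_ne_two hp] using h1)
  exact ⟨z, by simpa using hz⟩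

theorem exists_unit_not_isSquare_toZMod (hp : p ≠ 2) :
    ∃ e : ℤ_[p]ˣ, ¬ IsSquare (PadicInt.toZMod (e : ℤ_[p])) := by
  obtain ⟨t, ht⟩ := FiniteField.exists_nonsquare (F := ZMod p) (by rwa [ZMod.ringChar_zmod_n])
  obtain ⟨x, rfl⟩ := ZMod.ringHom_surjective (PadicInt.toZMod (p := p)) t
  have hx : IsUnit x := by
    by_contra hx
    rw [PadicInt.isUnit_iff, ← PadicInt.isUnit_iff, PadicInt.not_isUnit_iff,
      PadicInt.norm_lt_one_iff_dvd, ← toZMod_eq_zero_iff] at hx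
    rw [hx] at ht
    exact ht ⟨0, by simp⟩
  exact ⟨hx.unit, ht⟩

theorem toZMod_unit_ne_zero (u : ℤ_[p]ˣ) : PadicInt.toZMod (u : ℤ_[p]) ≠ 0 :=
  (u.isUnit.map PadicInt.toZMod).ne_zero

theorem exists_sq_or_mul_eq_sq (hp : p ≠ 2) {e : ℤ_[p]ˣ}
    (he : ¬ IsSquare (PadicInt.toZMod (e : ℤ_[p]))) (u : ℤ_[p]ˣ) :
    (∃ z : ℤ_[p], (u : ℤ_[p]) = z ^ 2) ∨ ∃ z : ℤ_[p], (e * u : ℤ_[p]) = z ^ 2 := by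
  by_cases hu : IsSquare (PadicInt.toZMod (u : ℤ_[p]))
  · exact Or.inl (exists_sq_of_isSquare_toZMod hp u hu)
  · right
    have h2 : ringChar (ZMod p) ≠ 2 := by rwa [ZMod.ringChar_zmod_n]
    have := exists_sq_of_isSquare_toZMod hp (e * u) (by
      rw [← quadraticChar_one_iff_isSquare (toZMod_unit_ne_zero _)]
      rw [← quadraticChar_neg_one_iff_not_isSquare] at he hu
      rw [Units.val_mul, map_mul, map_mul, he, hu]
      norm_num)
    simpa using this

theorem eq_zero_of_mul_sq_eq_sq {F : Type*} [Field F] {e x y : F} (he : ¬ IsSquare e)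
    (h : e * y ^ 2 = x ^ 2) : x = 0 ∧ y = 0 := by
  have hy : y = 0 := by
    by_contra hy
    exact he ⟨x / y, by field_simp; exact h⟩
  subst hy
  exact ⟨by simpa using h.symm, rfl⟩

theorem isQuadNorm_unit (hp : p ≠ 2) (e u : ℤ_[p]ˣ) :
    IsQuadNorm ((e : ℤ_[p]) : ℚ_[p]) (u : ℤ_[p]) := by
  obtain ⟨s, t, hst⟩ := FiniteField.exists_root_sum_quadratic (R := ZMod p)
    (f := Polynomial.X ^ 2 - Polynomial.C (PadicInt.toZMod (u : ℤ_[p])))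
    (g := Polynomial.C (-PadicInt.toZMod (e : ℤ_[p])) * Polynomial.X ^ 2)
    (Polynomial.degree_X_pow_sub_C (by decide) _)
    (by rw [Polynomial.degree_C_mul_X_pow _ (neg_ne_zero.2 (toZMod_unit_ne_zero e))]; rfl)
    (by rw [ZMod.card]; exact ((Fact.out : p.Prime).eq_two_or_odd).resolve_left hp)
  obtain ⟨x, rfl⟩ := ZMod.ringHom_surjective (PadicInt.toZMod (p := p)) s
  obtain ⟨y, rfl⟩ := ZMod.ringHom_surjective (PadicInt.toZMod (p := p)) t
  have h1 : ‖u * 1 ^ 2 - (x ^ 2 - e * y ^ 2)‖ < 1 := by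
    rw [PadicInt.norm_lt_one_iff_dvd, ← toZMod_eq_zero_iff]
    simp at hst
    simp
    linear_combination -hst
  obtain ⟨z, hz⟩ := exists_eq_mul_sq_of_norm_lt (r := (u : ℤ_[p])) (x := 1)
    (u := x ^ 2 - e * y ^ 2) (by
      simpa [norm_two_of_ne_two hp] using h1)
  have hz0 : z ≠ 0 := by
    rintro rfl
    simp only [hz] at h1
    simp at h1
  have hz0' : (z : ℚ_[p]) ≠ 0 := by simpa using hz0
  rw [← isQuadNorm_mul_sq_iff hz0']
  exact ⟨x, y, by simpa using congrArg (Subtype.val : ℤ_[p] → ℚ_[p]) hz.symm⟩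

theorem p_ne_zero : (p : ℚ_[p]) ≠ 0 := by exact_mod_cast (Fact.out : p.Prime).ne_zero

theorem unit_ne_zero (u : ℤ_[p]ˣ) : ((u : ℤ_[p]) : ℚ_[p]) ≠ 0 := by
  simp

theorem quadNormIndexTwo_unit (hp : p ≠ 2) {e : ℤ_[p]ˣ}
    (he : ¬ IsSquare (PadicInt.toZMod (e : ℤ_[p]))) :
    QuadNormIndexTwo ((e : ℤ_[p]) : ℚ_[p]) := by
  refine ⟨p, p_ne_zero, ?_, fun b hb => ?_⟩
  · have := not_isQuadNorm_of_imprimitive (p := p) (a := e) (w := p) (fun x y z h => by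
      have h1 := congrArg PadicInt.toZMod h
      simp at h1
      obtain ⟨hx, hy⟩ := eq_zero_of_mul_sq_eq_sq he (sub_eq_zero.1 h1.symm).symm
      rw [toZMod_eq_zero_iff] at hx hy
      refine ⟨hx, hy, ?_⟩
      obtain ⟨x, rfl⟩ := hx
      obtain ⟨y, rfl⟩ := hy
      refine PadicInt.prime_p.dvd_of_dvd_pow (n := 2) ⟨x ^ 2 - e * y ^ 2, ?_⟩
      apply mul_left_cancel₀ (PadicInt.prime_p (p := p)).ne_zero
      rw [h]
      ring)
    simpa using this
  · obtain ⟨u, s, hs, rfl | rfl⟩ := exists_unit_mul_sq b hb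
    · exact Or.inl ((isQuadNorm_mul_sq_iff hs).2 (isQuadNorm_unit hp e u))
    · right
      rw [show (p : ℚ_[p]) * (p * (u : ℤ_[p]) * s ^ 2) = (u : ℤ_[p]) * (p * s) ^ 2 by ring]
      exact (isQuadNorm_mul_sq_iff (mul_ne_zero p_ne_zero hs)).2 (isQuadNorm_unit hp e u)

theorem isQuadNorm_or_of_unit (hp : p ≠ 2) {e : ℤ_[p]ˣ}
    (he : ¬ IsSquare (PadicInt.toZMod (e : ℤ_[p]))) (a : ℚ_[p]) (u : ℤ_[p]ˣ) :
    IsQuadNorm a (u : ℤ_[p]) ∨ IsQuadNorm a ((e : ℤ_[p]) * (u : ℤ_[p])) := by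
  rcases exists_sq_or_mul_eq_sq hp he u with ⟨z, hz⟩ | ⟨z, hz⟩
  · left
    rw [hz]
    simpa using isQuadNorm_sq a (z : ℚ_[p])
  · right
    rw [← PadicInt.coe_mul, hz]
    simpa using isQuadNorm_sq a (z : ℚ_[p])

theorem quadNormIndexTwo_uniformizer (hp : p ≠ 2) (u : ℤ_[p]ˣ) :
    QuadNormIndexTwo ((p : ℚ_[p]) * (u : ℤ_[p])) := by
  obtain ⟨e, he⟩ := exists_unit_not_isSquare_toZMod hp
  refine ⟨(e : ℤ_[p]), unit_ne_zero e, ?_, fun b hb => ?_⟩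
  · have := not_isQuadNorm_of_imprimitive (p := p) (a := p * u) (w := e) (fun x y z h => by
      have h1 := congrArg PadicInt.toZMod h
      simp at h1
      obtain ⟨hx, hz⟩ := eq_zero_of_mul_sq_eq_sq he h1
      rw [toZMod_eq_zero_iff] at hx hz
      refine ⟨hx, ?_, hz⟩
      obtain ⟨x, rfl⟩ := hx
      obtain ⟨z, rfl⟩ := hz
      have h2 : (p : ℤ_[p]) ∣ u * y ^ 2 := by
        refine ⟨x ^ 2 - e * z ^ 2, ?_⟩
        apply mul_left_cancel₀ (PadicInt.prime_p (p := p)).ne_zero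
        linear_combination h
      rw [u.isUnit.dvd_mul_left] at h2
      exact PadicInt.prime_p.dvd_of_dvd_pow h2)
    simpa using this
  · obtain ⟨v, s, hs, rfl | rfl⟩ := exists_unit_mul_sq b hb
    · rw [← mul_assoc, isQuadNorm_mul_sq_iff hs, isQuadNorm_mul_sq_iff hs]
      exact isQuadNorm_or_of_unit hp he _ v
    · have hu := unit_ne_zero u
      rw [← mul_assoc, isQuadNorm_mul_sq_iff hs, isQuadNorm_mul_sq_iff hs]
      have hn := isQuadNorm_neg_self ((p : ℚ_[p]) * (u : ℤ_[p]))
      have h : IsQuadNorm _ _ ∨ IsQuadNorm _ _ :=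
        isQuadNorm_or_of_unit hp he ((p : ℚ_[p]) * (u : ℤ_[p])) (-v * u⁻¹)
      have hv : (((-v * u⁻¹ : ℤ_[p]ˣ) : ℤ_[p]) : ℚ_[p]) * (u : ℤ_[p]) = -(v : ℤ_[p]) := by
        rw [← PadicInt.coe_mul, ← Units.val_mul, inv_mul_cancel_right]
        simp
      refine h.imp (fun h => ?_) (fun h => ?_)
      · convert hn.mul h using 1
        linear_combination (p : ℚ_[p]) * hv
      · convert hn.mul h using 1
        linear_combination ((p : ℚ_[p]) * (e : ℤ_[p])) * hv

theorem quadNormIndexTwo_of_odd (hp : p ≠ 2) {a : ℚ_[p]} (ha : a ≠ 0) (hsq : ¬ IsSquare a) :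
    QuadNormIndexTwo a := by
  obtain ⟨u, s, hs, rfl | rfl⟩ := exists_unit_mul_sq a ha
  · refine (quadNormIndexTwo_unit hp fun h => hsq ?_).mul_sq hs
    obtain ⟨z, hz⟩ := exists_sq_of_isSquare_toZMod hp u h
    exact ⟨z * s, by rw [hz]; push_cast; ring⟩
  · exact (quadNormIndexTwo_uniformizer hp u).mul_sq hs

theorem isQuadNorm_two_of_dvd {a t x y : ℤ} (h : 128 ∣ t - (x ^ 2 - a * y ^ 2)) (ht : ¬ 8 ∣ t) :
    IsQuadNorm (a : ℚ_[2]) (t : ℚ_[2]) := by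
  have h1 : ‖(t : ℤ_[2]) * 1 ^ 2 - ((x ^ 2 - a * y ^ 2 : ℤ) : ℤ_[2])‖ ≤
      ((2 : ℕ) : ℝ) ^ (-(7 : ℕ) : ℤ) := by
    rw [one_pow, mul_one, ← Int.cast_sub, PadicInt.norm_int_le_pow_iff_dvd]
    simpa using h
  have h2 : ((2 : ℕ) : ℝ) ^ (-3 : ℤ) ≤ ‖2 * (t : ℤ_[2]) * 1‖ := by
    by_contra! h2
    have h3 := (PadicInt.norm_le_pow_iff_norm_lt_pow_add_one (2 * (t : ℤ_[2]) * 1) (-(4 : ℕ))).2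
      (by simpa using h2)
    rw [show (2 * (t : ℤ_[2]) * 1) = ((2 * t : ℤ) : ℤ_[2]) by push_cast; ring,
      PadicInt.norm_int_le_pow_iff_dvd] at h3
    norm_num at h3
    omega
  obtain ⟨z, hz⟩ := exists_eq_mul_sq_of_norm_lt (h1.trans_lt (lt_of_lt_of_le (by norm_num)
    (pow_le_pow_left₀ (by positivity) h2 2)))
  have hz' : (x ^ 2 - a * y ^ 2 : ℚ_[2]) = t * z ^ 2 := by
    simpa using congrArg (Subtype.val : ℤ_[2] → ℚ_[2]) hz
  by_cases hz0 : z = 0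
  · subst hz0
    have h3 : ‖(2 : ℤ_[2])‖ * ‖(t : ℤ_[2])‖ ≤ 1 * ‖(t : ℤ_[2])‖ :=
      mul_le_mul_of_nonneg_right (PadicInt.norm_le_one _) (norm_nonneg _)
    rw [hz] at h1
    simp at h1 h2
    norm_num at h1 h2
    linarith
  · have hz0' : (z : ℚ_[2]) ≠ 0 := by simpa using hz0
    rw [← isQuadNorm_mul_sq_iff hz0']
    exact ⟨x, y, hz'.symm⟩

theorem exists_unit_eq_mul_sq_two (u : ℤ_[2]ˣ) :
    ∃ r ∈ ([1, 3, 5, 7] : List ℤ), ∃ z : ℚ_[2], z ≠ 0 ∧ ((u : ℤ_[2]) : ℚ_[2]) = r * z ^ 2 := by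
  have hlt : (u : ℤ_[2]).appr 3 < 2 ^ 3 := PadicInt.appr_lt _ 3
  have hs := PadicInt.appr_spec 3 (u : ℤ_[2])
  generalize (u : ℤ_[2]).appr 3 = n at hlt hs
  rw [Ideal.mem_span_singleton] at hs
  obtain ⟨k, hk⟩ := hs
  have hodd : ¬ 2 ∣ n := by
    rintro ⟨m, rfl⟩
    have : ((2 : ℕ) : ℤ_[2]) ∣ u := ⟨m + 4 * k, by
      push_cast at hk ⊢
      linear_combination hk⟩
    rw [← PadicInt.norm_lt_one_iff_dvd, PadicInt.norm_units] at this
    exact lt_irrefl _ this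
  have h1 : ‖((n : ℤ) : ℤ_[2]) * 1 ^ 2 - u‖ ≤ ((2 : ℕ) : ℝ) ^ (-(3 : ℕ) : ℤ) := by
    rw [PadicInt.norm_le_pow_iff_mem_span_pow, Ideal.mem_span_singleton]
    exact ⟨-k, by push_cast at hk ⊢; linear_combination -hk⟩
  have h2 : ((2 : ℕ) : ℝ) ^ (-1 : ℤ) ≤ ‖2 * ((n : ℤ) : ℤ_[2]) * 1‖ := by
    by_contra! h2
    have h3 := (PadicInt.norm_le_pow_iff_norm_lt_pow_add_one (2 * ((n : ℤ) : ℤ_[2]) * 1)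
      (-(2 : ℕ))).2 (by simpa using h2)
    rw [show (2 * ((n : ℤ) : ℤ_[2]) * 1) = ((2 * n : ℤ) : ℤ_[2]) by push_cast; ring,
      PadicInt.norm_int_le_pow_iff_dvd] at h3
    norm_num at h3
    omega
  obtain ⟨z, hz⟩ := exists_eq_mul_sq_of_norm_lt (h1.trans_lt (lt_of_lt_of_le (by norm_num)
    (pow_le_pow_left₀ (by positivity) h2 2)))
  have hz' : ((u : ℤ_[2]) : ℚ_[2]) = (n : ℤ) * (z : ℚ_[2]) ^ 2 := by
    simpa using congrArg (Subtype.val : ℤ_[2] → ℚ_[2]) hz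
  refine ⟨n, ?_, z, ?_, hz'⟩
  · simp only [List.mem_cons, List.not_mem_nil, or_false]
    omega
  · intro hz0
    rw [hz0] at hz'
    simp at hz'

theorem exists_eq_mul_sq_two {b : ℚ_[2]} (hb : b ≠ 0) :
    ∃ r ∈ ([1, 3, 5, 7, 2, 6, 10, 14] : List ℤ), ∃ z : ℚ_[2], z ≠ 0 ∧ b = r * z ^ 2 := by
  obtain ⟨u, s, hs, h⟩ := exists_unit_mul_sq b hb
  obtain ⟨r, hr, z, hz, hu⟩ := exists_unit_eq_mul_sq_two u
  rw [hu] at h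
  rcases h with rfl | rfl
  · refine ⟨r, ?_, z * s, mul_ne_zero hz hs, by ring⟩
    simp only [List.mem_cons, List.not_mem_nil, or_false] at hr ⊢
    omega
  · refine ⟨2 * r, ?_, z * s, mul_ne_zero hz hs, by push_cast; ring⟩
    simp only [List.mem_cons, List.not_mem_nil, or_false] at hr ⊢
    omega

theorem two_dvd_of_toZModPow {x : ℤ_[2]} (h : 4 * PadicInt.toZModPow 3 x = 0) :
    ((2 : ℕ) : ℤ_[2]) ∣ x := by
  have h1 : 4 * x ∈ RingHom.ker (PadicInt.toZModPow (p := 2) 3) := by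
    rw [RingHom.mem_ker, map_mul, map_ofNat]
    exact h
  rw [PadicInt.ker_toZModPow, Ideal.mem_span_singleton] at h1
  obtain ⟨k, hk⟩ := h1
  refine ⟨k, mul_left_cancel₀ (by norm_num : (4 : ℤ_[2]) ≠ 0) ?_⟩
  rw [hk]
  push_cast
  ring

theorem not_isQuadNorm_two {a w : ℤ}
    (h : ∀ x y z : ZMod (2 ^ 3), (w : ZMod (2 ^ 3)) * z ^ 2 = x ^ 2 - (a : ZMod (2 ^ 3)) * y ^ 2 →
      4 * x = 0 ∧ 4 * y = 0 ∧ 4 * z = 0) :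
    ¬ IsQuadNorm (a : ℚ_[2]) (w : ℚ_[2]) := by
  have := not_isQuadNorm_of_imprimitive (p := 2) (a := a) (w := w) (fun x y z hxyz => by
    obtain ⟨hx, hy, hz⟩ := h (PadicInt.toZModPow 3 x) (PadicInt.toZModPow 3 y)
      (PadicInt.toZModPow 3 z) (by simpa using congrArg (PadicInt.toZModPow 3) hxyz)
    exact ⟨two_dvd_of_toZModPow hx, two_dvd_of_toZModPow hy, two_dvd_of_toZModPow hz⟩)
  simpa using this

theorem quadNormIndexTwo_two_of {a w : ℤ} (hw : w ≠ 0)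
    (h : ∀ x y z : ZMod (2 ^ 3), (w : ZMod (2 ^ 3)) * z ^ 2 = x ^ 2 - (a : ZMod (2 ^ 3)) * y ^ 2 →
      4 * x = 0 ∧ 4 * y = 0 ∧ 4 * z = 0)
    (hc : ∀ b ∈ ([1, 3, 5, 7, 2, 6, 10, 14] : List ℤ), ∃ x ∈ List.range 32, ∃ y ∈ List.range 32,
      (128 ∣ b - ((x : ℤ) ^ 2 - a * (y : ℤ) ^ 2) ∨
        128 ∣ w * b - ((x : ℤ) ^ 2 - a * (y : ℤ) ^ 2) ∧ ¬ 8 ∣ w * b)) :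
    QuadNormIndexTwo (a : ℚ_[2]) := by
  refine ⟨w, by exact_mod_cast hw, not_isQuadNorm_two h, fun b hb => ?_⟩
  obtain ⟨r, hr, z, hz, rfl⟩ := exists_eq_mul_sq_two hb
  rw [← mul_assoc, isQuadNorm_mul_sq_iff hz, isQuadNorm_mul_sq_iff hz]
  obtain ⟨x, -, y, -, hxy⟩ := hc r hr
  refine hxy.imp (fun hxy => isQuadNorm_two_of_dvd hxy ?_) (fun hxy => ?_)
  · simp only [List.mem_cons, List.not_mem_nil, or_false] at hr
    omega
  · have := isQuadNorm_two_of_dvd hxy.1 hxy.2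
    rwa [Int.cast_mul] at this

theorem quadNormIndexTwo_of_two {a : ℚ_[2]} (ha : a ≠ 0) (hsq : ¬ IsSquare a) :
    QuadNormIndexTwo a := by
  obtain ⟨r, hr, z, hz, rfl⟩ := exists_eq_mul_sq_two ha
  refine QuadNormIndexTwo.mul_sq hz ?_
  simp only [List.mem_cons, List.not_mem_nil, or_false] at hr
  rcases hr with rfl | rfl | rfl | rfl | rfl | rfl | rfl | rfl
  · exact absurd ⟨z, by push_cast; ring⟩ hsq
  · exact quadNormIndexTwo_two_of (w := 7) (by decide) (by decide +kernel) (by decide +kernel)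
  · exact quadNormIndexTwo_two_of (w := 2) (by decide) (by decide +kernel) (by decide +kernel)
  · exact quadNormIndexTwo_two_of (w := 7) (by decide) (by decide +kernel) (by decide +kernel)
  all_goals
    exact quadNormIndexTwo_two_of (w := 5) (by decide) (by decide +kernel) (by decide +kernel)

theorem quadNormIndexTwo {a : ℚ_[p]} (ha : a ≠ 0) (hsq : ¬ IsSquare a) : QuadNormIndexTwo a := by
  by_cases hp : p = 2
  · subst hp
    exact quadNormIndexTwo_of_two ha hsq
  · exact quadNormIndexTwo_of_odd hp ha hsq

theorem not_isSquare_of_odd_valuation {x : ℚ_[p]} (hx : Odd x.valuation) : ¬ IsSquare x := by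
  rintro ⟨y, rfl⟩
  by_cases hy : y = 0
  · simp [hy] at hx
  · rw [Padic.valuation_mul hy hy] at hx
    exact Int.not_even_iff_odd.2 hx ⟨_, rfl⟩

theorem exists_unit_not_isSquare : ∃ u : ℤ_[p]ˣ, ¬ IsSquare ((u : ℤ_[p]) : ℚ_[p]) := by
  by_contra! h
  obtain ⟨w, hw, hn, -⟩ := quadNormIndexTwo (p := p) (a := p) p_ne_zero
    (not_isSquare_of_odd_valuation (by simp))
  obtain ⟨u, s, hs, rfl | rfl⟩ := exists_unit_mul_sq w hw
  · obtain ⟨z, hz⟩ := h u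
    rw [isQuadNorm_mul_sq_iff hs, hz, ← sq] at hn
    exact hn (isQuadNorm_sq _ _)
  · obtain ⟨z, hz⟩ := h (-u)
    refine hn ((isQuadNorm_mul_sq_iff hs).2 ?_)
    convert (isQuadNorm_neg_self (p : ℚ_[p])).mul (isQuadNorm_sq _ z) using 1
    rw [sq, ← hz]
    simp

/-- `ℚ_p` has at least three square classes. -/
theorem exists_square_classes : ∃ u v : ℚ_[p], u ≠ 0 ∧ v ≠ 0 ∧ ¬ IsSquare u ∧ ¬ IsSquare v ∧
    ¬ IsSquare (u * v) := by
  obtain ⟨u, hu⟩ := exists_unit_not_isSquare (p := p)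
  have hv : ((u : ℤ_[p]) : ℚ_[p]).valuation = 0 := by
    have h := Padic.norm_eq_zpow_neg_valuation (unit_ne_zero u)
    rw [← PadicInt.norm_def, PadicInt.norm_units, eq_comm,
      zpow_eq_one_iff_right₀ (by positivity)
        (by exact_mod_cast (Fact.out : p.Prime).one_lt.ne')] at h
    exact neg_eq_zero.1 h
  refine ⟨p, u, p_ne_zero, unit_ne_zero u, not_isSquare_of_odd_valuation (by simp), hu,
    not_isSquare_of_odd_valuation ?_⟩
  rw [Padic.valuation_mul p_ne_zero (unit_ne_zero u), hv]
  simp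

end Padic

/-- The properties of the square classes of a `p`-adic field from which the classification of
quadratic forms is deduced. -/
structure LocalSquareClasses (K : Type*) [Field K] : Prop where
  two_ne_zero : (2 : K) ≠ 0
  index_two : ∀ a : K, a ≠ 0 → ¬ IsSquare a → QuadNormIndexTwo a
  exists_classes : ∃ u v : K, u ≠ 0 ∧ v ≠ 0 ∧ ¬ IsSquare u ∧ ¬ IsSquare v ∧ ¬ IsSquare (u * v)

section HilbertSymbol

variable {K : Type*} [Field K] {a b c : K}

theorem hilbertSym_eq_one_or (a b : K) : hilbertSym K a b = 1 ∨ hilbertSym K a b = -1 := by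
  unfold hilbertSym
  split_ifs <;> simp

theorem hilbertSym_mul_self (a b : K) : hilbertSym K a b * hilbertSym K a b = 1 := by
  rcases hilbertSym_eq_one_or a b with h | h <;> simp [h]

theorem hilbertSym_comm (a b : K) : hilbertSym K a b = hilbertSym K b a := by
  unfold hilbertSym
  congr 1
  apply propext
  constructor <;>
  · rintro ⟨x, y, z, h0, h⟩
    exact ⟨y, x, z, by simp only [ne_eq, Prod.mk.injEq] at h0 ⊢; tauto, by rw [h]; ring⟩

theorem isQuadNorm_of_isSquare (h2 : (2 : K) ≠ 0) (ha : a ≠ 0) (hsq : IsSquare a) (b : K) :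
    IsQuadNorm a b := by
  obtain ⟨s, rfl⟩ := hsq
  have hs : s ≠ 0 := by
    rintro rfl
    simp at ha
  refine ⟨(b + 1) / 2, (b - 1) / (2 * s), ?_⟩
  field_simp
  ring

theorem hilbertSym_eq_one_iff (h2 : (2 : K) ≠ 0) (ha : a ≠ 0) :
    hilbertSym K a b = 1 ↔ IsQuadNorm a b := by
  have : hilbertSym K a b = 1 ↔
      ∃ x y z : K, (x, y, z) ≠ (0, 0, 0) ∧ z ^ 2 = a * x ^ 2 + b * y ^ 2 := by
    unfold hilbertSym
    split_ifs with h
    · simpa using h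
    · simpa using h
  rw [this]
  constructor
  · rintro ⟨x, y, z, h0, h⟩
    by_cases hy : y = 0
    · subst hy
      have hx : x ≠ 0 := by
        rintro rfl
        simp at h
        simp [h] at h0
      exact isQuadNorm_of_isSquare h2 ha ⟨z / x, by field_simp; rw [h]; ring⟩ b
    · refine ⟨z / y, x / y, ?_⟩
      field_simp
      linear_combination -h
  · rintro ⟨x, y, rfl⟩
    exact ⟨y, 1, x, by simp, by ring⟩

variable (hK : LocalSquareClasses K)
include hK

theorem LocalSquareClasses.hilbertSym_mul (ha : a ≠ 0) (hb : b ≠ 0) (hc : c ≠ 0) :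
    hilbertSym K a (b * c) = hilbertSym K a b * hilbertSym K a c := by
  have hiff : ∀ d : K, hilbertSym K a d = 1 ↔ IsQuadNorm a d := fun d =>
    hilbertSym_eq_one_iff hK.two_ne_zero ha
  have key : ∀ {d e : K}, d ≠ 0 → IsQuadNorm a d → IsQuadNorm a (d * e) → IsQuadNorm a e := by
    intro d e hd h1 h2
    have := (h1.mul h2)
    rw [show d * (d * e) = e * d ^ 2 by ring] at this
    exact (isQuadNorm_mul_sq_iff hd).1 this
  have h1 := hiff b
  have h2 := hiff c
  have h3 := hiff (b * c)
  by_cases hB : IsQuadNorm a b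
  · rw [h1.2 hB, one_mul]
    by_cases hC : IsQuadNorm a c
    · rw [h2.2 hC, h3.2 (hB.mul hC)]
    · rw [((hilbertSym_eq_one_or a c).resolve_left (mt h2.1 hC)),
        (hilbertSym_eq_one_or a (b * c)).resolve_left (mt h3.1 fun h => hC (key hb hB h))]
  · rw [((hilbertSym_eq_one_or a b).resolve_left (mt h1.1 hB))]
    by_cases hC : IsQuadNorm a c
    · rw [h2.2 hC, (hilbertSym_eq_one_or a (b * c)).resolve_left
        (mt h3.1 fun h => hB (key hc hC (by rwa [mul_comm]))), mul_one]
    · rw [((hilbertSym_eq_one_or a c).resolve_left (mt h2.1 hC)), h3.2, neg_one_mul, neg_neg]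
      obtain ⟨w, hw, -, hcov⟩ := hK.index_two a ha fun hsq =>
        hB (isQuadNorm_of_isSquare hK.two_ne_zero ha hsq b)
      have := ((hcov b hb).resolve_left hB).mul ((hcov c hc).resolve_left hC)
      rw [show w * b * (w * c) = b * c * w ^ 2 by ring] at this
      exact (isQuadNorm_mul_sq_iff hw).1 this

theorem LocalSquareClasses.mul_hilbertSym (ha : a ≠ 0) (hb : b ≠ 0) (hc : c ≠ 0) :
    hilbertSym K (a * b) c = hilbertSym K a c * hilbertSym K b c := by
  simp only [hilbertSym_comm _ c, hK.hilbertSym_mul hc ha hb]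

theorem LocalSquareClasses.hilbertSym_of_isSquare (ha : a ≠ 0) (hsq : IsSquare a) (b : K) :
    hilbertSym K a b = 1 :=
  (hilbertSym_eq_one_iff hK.two_ne_zero ha).2 (isQuadNorm_of_isSquare hK.two_ne_zero ha hsq b)

theorem LocalSquareClasses.hilbertSym_self_neg (ha : a ≠ 0) : hilbertSym K a (-a) = 1 :=
  (hilbertSym_eq_one_iff hK.two_ne_zero ha).2 (isQuadNorm_neg_self a)

theorem LocalSquareClasses.exists_hilbertSym_eq_neg_one (ha : a ≠ 0) (hsq : ¬ IsSquare a) :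
    ∃ x : K, x ≠ 0 ∧ hilbertSym K x a = -1 := by
  obtain ⟨w, hw, hn, -⟩ := hK.index_two a ha hsq
  refine ⟨w, hw, ?_⟩
  rw [hilbertSym_comm]
  exact (hilbertSym_eq_one_or a w).resolve_left
    (mt (hilbertSym_eq_one_iff hK.two_ne_zero ha).1 hn)

theorem LocalSquareClasses.hilbertSym_congr_right {s : K} (ha : a ≠ 0) (hb : b ≠ 0) (hs : s ≠ 0)
    (h : c = s ^ 2 * b) : hilbertSym K a c = hilbertSym K a b := by
  rw [h, hK.hilbertSym_mul ha (pow_ne_zero 2 hs) hb, hilbertSym_comm a,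
    hK.hilbertSym_of_isSquare (pow_ne_zero 2 hs) ⟨s, sq s⟩, one_mul]

/-- A binary form `⟨a, b⟩` represents `c` if and only if `(c, -ab) = (a, b)`. -/
theorem LocalSquareClasses.exists_eq_add_iff (ha : a ≠ 0) (hb : b ≠ 0) (hc : c ≠ 0) :
    (∃ x y : K, c = a * x ^ 2 + b * y ^ 2) ↔
      hilbertSym K c (-(a * b)) = hilbertSym K a b := by
  have hab : -(a * b) ≠ 0 := neg_ne_zero.2 (mul_ne_zero ha hb)
  have h1 : hilbertSym K a (-(a * b)) = hilbertSym K a b := by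
    rw [← neg_mul, hK.hilbertSym_mul ha (neg_ne_zero.2 ha) hb, hK.hilbertSym_self_neg ha, one_mul]
  have h2 : hilbertSym K c (-(a * b)) = hilbertSym K a b ↔ hilbertSym K (-(a * b)) (c * a) = 1 := by
    rw [← h1, hilbertSym_comm _ (c * a), hK.mul_hilbertSym hc ha hab]
    rcases hilbertSym_eq_one_or c (-(a * b)) with h | h <;>
    rcases hilbertSym_eq_one_or a (-(a * b)) with h' | h' <;> simp [h, h']
  rw [h2, hilbertSym_eq_one_iff hK.two_ne_zero hab]
  constructor
  · rintro ⟨x, y, rfl⟩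
    exact ⟨a * x, y, by ring⟩
  · rintro ⟨x, y, h⟩
    refine ⟨x / a, y, ?_⟩
    field_simp
    linear_combination h

/-- Existence of elements with prescribed Hilbert symbols against two elements. -/
theorem LocalSquareClasses.exists_hilbertSym_eq (ha : a ≠ 0) (hb : b ≠ 0)
    (hab : ¬ IsSquare (a * b)) {s t : ℤ} (hs : s = 1 ∨ s = -1) (ht : t = 1 ∨ t = -1)
    (hsa : IsSquare a → s = 1) (htb : IsSquare b → t = 1) :
    ∃ x : K, x ≠ 0 ∧ hilbertSym K x a = s ∧ hilbertSym K x b = t := by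
  have mul : ∀ {x y c : K}, x ≠ 0 → y ≠ 0 → c ≠ 0 →
    hilbertSym K (x * y) c = hilbertSym K x c * hilbertSym K y c := hK.mul_hilbertSym
  have one : ∀ c : K, hilbertSym K 1 c = 1 :=
    hK.hilbertSym_of_isSquare one_ne_zero ⟨1, by simp⟩
  obtain ⟨z, hz, hzab⟩ := hK.exists_hilbertSym_eq_neg_one (mul_ne_zero ha hb) hab
  rw [hK.hilbertSym_mul hz ha hb] at hzab
  have hn1 : (1 : ℤ) ≠ -1 := by decide
  have hn2 : (-1 : ℤ) ≠ 1 := by decide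
  rcases hs with rfl | rfl <;> rcases ht with rfl | rfl
  · exact ⟨1, one_ne_zero, one a, one b⟩
  · obtain ⟨y, hy, hyb⟩ := hK.exists_hilbertSym_eq_neg_one hb fun h => hn2 (htb h)
    rcases hilbertSym_eq_one_or y a with h1 | h1
    · exact ⟨y, hy, h1, hyb⟩
    rcases hilbertSym_eq_one_or z a with h2 | h2
    · exact ⟨z, hz, h2, by rw [h2] at hzab; linarith⟩
    · refine ⟨y * z, mul_ne_zero hy hz, by rw [mul hy hz ha, h1, h2]; rfl, ?_⟩
      rw [h2] at hzab
      rw [mul hy hz hb, hyb]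
      linarith
  · obtain ⟨x, hx, hxa⟩ := hK.exists_hilbertSym_eq_neg_one ha fun h => hn2 (hsa h)
    rcases hilbertSym_eq_one_or x b with h1 | h1
    · exact ⟨x, hx, hxa, h1⟩
    rcases hilbertSym_eq_one_or z b with h2 | h2
    · exact ⟨z, hz, by rw [h2] at hzab; linarith, h2⟩
    · refine ⟨x * z, mul_ne_zero hx hz, ?_, by rw [mul hx hz hb, h1, h2]; rfl⟩
      rw [h2] at hzab
      rw [mul hx hz ha, hxa]
      linarith
  · obtain ⟨x, hx, hxa⟩ := hK.exists_hilbertSym_eq_neg_one ha fun h => hn2 (hsa h)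
    obtain ⟨y, hy, hyb⟩ := hK.exists_hilbertSym_eq_neg_one hb fun h => hn2 (htb h)
    rcases hilbertSym_eq_one_or x b with h1 | h1
    · rcases hilbertSym_eq_one_or y a with h2 | h2
      · exact ⟨x * y, mul_ne_zero hx hy, by rw [mul hx hy ha, hxa, h2]; rfl,
          by rw [mul hx hy hb, hyb, h1]; rfl⟩
      · exact ⟨y, hy, h2, hyb⟩
    · exact ⟨x, hx, hxa, h1⟩

/-- A ternary form represents every `c` such that `-c` is not its discriminant. -/
theorem LocalSquareClasses.exists_eq_add_add {d : K} (ha : a ≠ 0) (hb : b ≠ 0) (hc : c ≠ 0)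
    (hd : d ≠ 0) (hsq : ¬ IsSquare (-(a * b * c) * d)) :
    ∃ x y z : K, d = a * x ^ 2 + b * y ^ 2 + c * z ^ 2 := by
  have hc' : -c ≠ 0 := neg_ne_zero.2 hc
  have hab : -(a * b) ≠ 0 := neg_ne_zero.2 (mul_ne_zero ha hb)
  have hdc : -(d * -c) ≠ 0 := neg_ne_zero.2 (mul_ne_zero hd hc')
  have aux : ∀ {e f : K}, e ≠ 0 → f ≠ 0 → IsSquare (-(e * f)) → hilbertSym K e f = 1 := by
    intro e f he hf h
    rw [← (hK.exists_eq_add_iff he hf he).1 ⟨1, 0, by ring⟩, hilbertSym_comm]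
    exact hK.hilbertSym_of_isSquare (neg_ne_zero.2 (mul_ne_zero he hf)) h e
  obtain ⟨w, hw, h1, h2⟩ := hK.exists_hilbertSym_eq hab hdc
    (by rwa [show -(a * b) * -(d * -c) = -(a * b * c) * d by ring])
    (hilbertSym_eq_one_or a b) (hilbertSym_eq_one_or d (-c)) (aux ha hb) (aux hd hc')
  obtain ⟨x, y, hxy⟩ := (hK.exists_eq_add_iff ha hb hw).2 h1
  obtain ⟨s, t, hst⟩ := (hK.exists_eq_add_iff hd hc' hw).2 h2
  by_cases hs : s = 0
  · subst hs
    have ht : t ≠ 0 := by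
      rintro rfl
      simp at hst
      exact hw hst
    have h20 := hK.two_ne_zero
    refine ⟨(d - c) / (2 * c) * (x / t), (d - c) / (2 * c) * (y / t), (d - c) / (2 * c) + 1, ?_⟩
    have h0 : a * x ^ 2 + b * y ^ 2 = -c * t ^ 2 := by rw [← hxy, hst]; ring
    have h3 : a * (x / t) ^ 2 + b * (y / t) ^ 2 = -c := by
      field_simp
      linear_combination h0
    have h4 : d = c * (2 * ((d - c) / (2 * c)) + 1) := by
      field_simp
      ring
    linear_combination h4 - ((d - c) / (2 * c)) ^ 2 * h3
  · refine ⟨x / s, y / s, t / s, ?_⟩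
    field_simp
    linear_combination hxy - hst

theorem LocalSquareClasses.exists_common (ha : a ≠ 0) (hb : b ≠ 0) :
    ∃ c : K, c ≠ 0 ∧ ¬ IsSquare (a * c) ∧ ¬ IsSquare (b * c) := by
  obtain ⟨u, v, hu, hv, hsu, hsv, hsuv⟩ := hK.exists_classes
  have key : ∀ {d x y : K}, d ≠ 0 → IsSquare (d * x) → IsSquare (d * y) → IsSquare (x * y) := by
    rintro d x y hd ⟨r, hr⟩ ⟨s, hs⟩
    refine ⟨r * s / d, ?_⟩
    field_simp
    linear_combination d * y * hr + r * r * hs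
  by_contra! h
  have h1 := h 1 one_ne_zero
  have h2 := h u hu
  have h3 := h v hv
  have k1 : ∀ {d : K}, d ≠ 0 → IsSquare (d * 1) → ¬ IsSquare (d * u) := fun hd h h' =>
    hsu (by simpa using key hd h h')
  have k2 : ∀ {d : K}, d ≠ 0 → IsSquare (d * 1) → ¬ IsSquare (d * v) := fun hd h h' =>
    hsv (by simpa using key hd h h')
  have k3 : ∀ {d : K}, d ≠ 0 → IsSquare (d * u) → ¬ IsSquare (d * v) := fun hd h h' =>
    hsuv (key hd h h')
  have a1 := k1 ha
  have a2 := k2 ha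
  have a3 := k3 ha
  have b1 := k1 hb
  have b2 := k2 hb
  have b3 := k3 hb
  tauto

end HilbertSymbol

section WittCancellation

variable {K : Type*} [Field K]

namespace QuadraticMap

/-- The reflection along an anisotropic vector, as an isometry. -/
theorem exists_isometryEquiv_reflection {M : Type*} [AddCommGroup M] [Module K M]
    (Q : QuadraticForm K M) {w : M} (hw : Q w ≠ 0) :
    ∃ e : Q.IsometryEquiv Q, ∀ x, e x = x - (polar Q w x / Q w) • w := by
  have h : ((Q w)⁻¹ • Q.polarBilin w) w = 2 := by
    simp only [LinearMap.smul_apply, polarBilin_apply_apply, polar_self, smul_eq_mul,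
      nsmul_eq_mul]
    push_cast
    field_simp
  have key : ∀ x, Module.reflection h x = x - (polar Q w x / Q w) • w := by
    intro x
    rw [Module.reflection_apply]
    simp [div_eq_inv_mul]
  refine ⟨⟨Module.reflection h, fun x => ?_⟩, key⟩
  change Q (Module.reflection h x) = Q x
  rw [key, sub_eq_add_neg, ← neg_smul, QuadraticMap.map_add Q, QuadraticMap.map_smul,
    polar_smul_right, polar_comm Q x w]
  simp only [smul_eq_mul]
  field_simp
  ring

theorem exists_isometryEquiv_apply_eq (h2 : (2 : K) ≠ 0) {M : Type*} [AddCommGroup M]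
    [Module K M] (Q : QuadraticForm K M) {u v : M} (huv : Q v = Q u) (hu : Q u ≠ 0) :
    ∃ e : Q.IsometryEquiv Q, e v = u := by
  have hsub : Q (u - v) = 2 * Q u - polar Q u v := by
    rw [sub_eq_add_neg, QuadraticMap.map_add Q, polar_neg_right, QuadraticMap.map_neg, huv]
    ring
  have hadd : Q (u + v) = 2 * Q u + polar Q u v := by
    rw [QuadraticMap.map_add Q, huv]
    ring
  by_cases h : Q (u - v) = 0
  · have h' : Q (u + v) ≠ 0 := by
      rw [hadd, ← sub_eq_zero.1 (hsub.symm.trans h)]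
      intro h0
      apply mul_ne_zero (mul_ne_zero h2 h2) hu
      linear_combination h0
    obtain ⟨e, he⟩ := exists_isometryEquiv_reflection Q h'
    let n : Q.IsometryEquiv Q := ⟨LinearEquiv.neg K, fun x => QuadraticMap.map_neg Q x⟩
    refine ⟨e.trans n, ?_⟩
    change -(e v) = u
    have : polar Q (u + v) v = Q (u + v) := by
      rw [polar_add_left, polar_self, huv, hadd]
      simp
      ring
    rw [he, this, div_self h', one_smul]
    abel
  · obtain ⟨e, he⟩ := exists_isometryEquiv_reflection Q h
    refine ⟨e, ?_⟩
    have : polar Q (u - v) v = -Q (u - v) := by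
      rw [polar_sub_left, polar_self, huv, hsub]
      simp
    rw [he, this, neg_div, div_self h, neg_one_smul]
    abel

/-- The form `c x²` in one variable. -/
def unary (c : K) : QuadraticForm K K := c • sq

@[simp]
theorem unary_apply (c x : K) : unary c x = c * (x * x) := rfl

theorem IsometryEquiv.fst_apply_eq_zero (h2 : (2 : K) ≠ 0) {M N : Type*} [AddCommGroup M]
    [Module K M] [AddCommGroup N] [Module K N] {Q : QuadraticForm K M} {R : QuadraticForm K N}
    {c : K} (hc : c ≠ 0) (e : ((unary c).prod Q).IsometryEquiv ((unary c).prod R))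
    (he : e (1, 0) = (1, 0)) (m : M) : (e (0, m)).1 = 0 := by
  have h1 := e.map_app ((1, 0) + (0, m))
  have h2' := e.map_app (0, m)
  rw [_root_.map_add e, he] at h1
  simp only [prod_apply, unary_apply, Prod.fst_add, Prod.snd_add, zero_add, add_zero] at h1 h2'
  have : c * (2 * (e (0, m)).1) = 0 := by linear_combination h1 - h2'
  simpa [hc, h2] using this

theorem Equivalent.of_unary_prod (h2 : (2 : K) ≠ 0) {M N : Type*} [AddCommGroup M] [Module K M]
    [AddCommGroup N] [Module K N] {Q : QuadraticForm K M} {R : QuadraticForm K N} {c : K}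
    (hc : c ≠ 0) (h : ((unary c).prod Q).Equivalent ((unary c).prod R)) : Q.Equivalent R := by
  obtain ⟨f⟩ := h
  obtain ⟨g, hg⟩ := exists_isometryEquiv_apply_eq h2 ((unary c).prod R) (u := (1, 0))
    (v := f (1, 0)) (by rw [f.map_app]; simp) (by simpa using hc)
  set e := f.trans g
  have he1 : e (1, 0) = (1, 0) := hg
  have he1' : e.symm (1, 0) = (1, 0) := by rw [e.symm_apply_eq, he1]
  have hM : ∀ m, e (0, m) = (0, (e (0, m)).2) := fun m =>
    Prod.ext (e.fst_apply_eq_zero h2 hc he1 m) rfl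
  have hN : ∀ n, e.symm (0, n) = (0, (e.symm (0, n)).2) :=
    fun n => Prod.ext (e.symm.fst_apply_eq_zero h2 hc he1' n) rfl
  refine ⟨⟨LinearEquiv.ofLinearMap
    (LinearMap.snd K K N ∘ₗ e.toLinearEquiv.toLinearMap ∘ₗ LinearMap.inr K K M)
    (LinearMap.snd K K M ∘ₗ e.symm.toLinearEquiv.toLinearMap ∘ₗ LinearMap.inr K K N) ?_ ?_, ?_⟩⟩
  · ext n
    change (e (0, (e.symm (0, n)).2)).2 = n
    rw [← hN, e.apply_symm_apply]
  · ext m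
    change (e.symm (0, (e (0, m)).2)).2 = m
    rw [← hM, e.symm_apply_apply]
  · intro m
    change R (e (0, m)).2 = Q m
    have h1 := e.map_app (0, m)
    rw [hM] at h1
    simpa using h1

theorem unary_prod_equivalent_cons {n : ℕ} (c : K) (a : Fin n → K) :
    ((unary c).prod (weightedSumSquares K a)).Equivalent
      (weightedSumSquares K (Fin.cons c a : Fin (n + 1) → K)) := by
  refine ⟨⟨Fin.consLinearEquiv K (fun _ : Fin (n + 1) => K), fun m => ?_⟩⟩
  change weightedSumSquares K (Fin.cons c a : Fin (n + 1) → K)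
    (Fin.cons m.1 m.2 : Fin (n + 1) → K) = _
  simp [weightedSumSquares_apply, Fin.sum_univ_succ]

theorem Equivalent.cons {n : ℕ} {a b : Fin n → K} (c : K)
    (h : (weightedSumSquares K a).Equivalent (weightedSumSquares K b)) :
    (weightedSumSquares K (Fin.cons c a : Fin (n + 1) → K)).Equivalent
      (weightedSumSquares K (Fin.cons c b : Fin (n + 1) → K)) :=
  ((unary_prod_equivalent_cons c a).symm.trans
    (QuadraticMap.Equivalent.prod (QuadraticMap.Equivalent.refl _) h)).trans
    (unary_prod_equivalent_cons c b)

theorem Equivalent.of_cons (h2 : (2 : K) ≠ 0) {n : ℕ} {a b : Fin n → K} {c : K} (hc : c ≠ 0)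
    (h : (weightedSumSquares K (Fin.cons c a : Fin (n + 1) → K)).Equivalent
      (weightedSumSquares K (Fin.cons c b : Fin (n + 1) → K))) :
    (weightedSumSquares K a).Equivalent (weightedSumSquares K b) :=
  of_unary_prod h2 hc (((unary_prod_equivalent_cons c a).trans h).trans
    (unary_prod_equivalent_cons c b).symm)

theorem equivalent_cons_mul_sq {n : ℕ} (a : Fin n → K) (c : K) {s : K} (hs : s ≠ 0) :
    (weightedSumSquares K (Fin.cons c a : Fin (n + 1) → K)).Equivalent
      (weightedSumSquares K (Fin.cons (c * s ^ 2) a : Fin (n + 1) → K)) := by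
  have h : (unary c).Equivalent (unary (c * s ^ 2)) := by
    refine ⟨⟨LinearEquiv.smulOfUnit (Units.mk0 s hs)⁻¹, fun x => ?_⟩⟩
    change unary (c * s ^ 2) (s⁻¹ * x) = _
    simp
    field_simp
  exact ((unary_prod_equivalent_cons c a).symm.trans
    (QuadraticMap.Equivalent.prod h (QuadraticMap.Equivalent.refl _))).trans
    (unary_prod_equivalent_cons _ a)

theorem equivalent_cons_cons {n : ℕ} (l : Fin n → K) {a b c x y : K} (hc : c ≠ 0)
    (h : c = a * x ^ 2 + b * y ^ 2) :
    (weightedSumSquares K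
        (Fin.cons a (Fin.cons b l : Fin (n + 1) → K) : Fin (n + 2) → K)).Equivalent
      (weightedSumSquares K
        (Fin.cons c (Fin.cons (a * b * c) l : Fin (n + 1) → K) : Fin (n + 2) → K)) := by
  have key : ((unary c).prod ((unary (a * b * c)).prod (weightedSumSquares K l))).Equivalent
      ((unary a).prod ((unary b).prod (weightedSumSquares K l))) := by
    let f : (K × K × (Fin n → K)) →ₗ[K] (K × K × (Fin n → K)) :=
      { toFun := fun m => (x * m.1 - b * y * m.2.1, y * m.1 + a * x * m.2.1, m.2.2)
        map_add' := fun m m' => by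
          ext <;> simp <;> ring
        map_smul' := fun t m => by
          ext <;> simp <;> ring }
    let g : (K × K × (Fin n → K)) →ₗ[K] (K × K × (Fin n → K)) :=
      { toFun := fun m => ((a * x * m.1 + b * y * m.2.1) / c, (x * m.2.1 - y * m.1) / c, m.2.2)
        map_add' := fun m m' => by
          ext <;> simp <;> ring
        map_smul' := fun t m => by
          ext <;> simp <;> ring }
    have hfg : ∀ m, f (g m) = m := by
      rintro ⟨m₁, m₂, m₃⟩
      refine Prod.ext ?_ (Prod.ext ?_ rfl)
      · change x * ((a * x * m₁ + b * y * m₂) / c) - b * y * ((x * m₂ - y * m₁) / c) = m₁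
        field_simp
        rw [h]
        ring
      · change y * ((a * x * m₁ + b * y * m₂) / c) + a * x * ((x * m₂ - y * m₁) / c) = m₂
        field_simp
        rw [h]
        ring
    have hgf : ∀ m, g (f m) = m := by
      rintro ⟨m₁, m₂, m₃⟩
      refine Prod.ext ?_ (Prod.ext ?_ rfl)
      · change (a * x * (x * m₁ - b * y * m₂) + b * y * (y * m₁ + a * x * m₂)) / c = m₁
        field_simp
        rw [h]
        ring
      · change (x * (y * m₁ + a * x * m₂) - y * (x * m₁ - b * y * m₂)) / c = m₂
        field_simp
        rw [h]
        ring
    refine ⟨⟨LinearEquiv.ofLinearMap f g (LinearMap.ext hfg) (LinearMap.ext hgf), ?_⟩⟩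
    rintro ⟨m₁, m₂, m₃⟩
    change ((unary a).prod ((unary b).prod (weightedSumSquares K l)))
      (x * m₁ - b * y * m₂, y * m₁ + a * x * m₂, m₃) = _
    simp only [prod_apply, unary_apply]
    rw [h]
    ring
  have step : ∀ s t : K, ((unary s).prod ((unary t).prod (weightedSumSquares K l))).Equivalent
      (weightedSumSquares K
        (Fin.cons s (Fin.cons t l : Fin (n + 1) → K) : Fin (n + 2) → K)) := fun s t =>
    (QuadraticMap.Equivalent.prod (QuadraticMap.Equivalent.refl _)
      (unary_prod_equivalent_cons t l)).trans
      (unary_prod_equivalent_cons s _)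
  exact ((step a b).symm.trans key.symm).trans (step c (a * b * c))

theorem weightedSumSquares_cons {n : ℕ} (c : K) (a : Fin n → K) (v : Fin (n + 1) → K) :
    weightedSumSquares K (Fin.cons c a : Fin (n + 1) → K) v =
      c * v 0 ^ 2 + weightedSumSquares K a (Fin.tail v) := by
  simp [weightedSumSquares_apply, Fin.sum_univ_succ, Fin.tail]
  exact Or.inl (pow_two _).symm

end QuadraticMap

end WittCancellation

section Classification

open QuadraticMap

variable {K : Type*} [Field K] {n : ℕ}

/-- Two diagonal forms have the same discriminant and the same Hasse invariant. -/
structure SameInvariants (a b : Fin n → K) : Prop where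
  disc : ∃ s : K, s ≠ 0 ∧ ∏ i, a i = s ^ 2 * ∏ i, b i
  hasse : hasseInv K a = hasseInv K b

theorem SameInvariants.refl (a : Fin n → K) : SameInvariants a a :=
  ⟨⟨1, one_ne_zero, by simp⟩, rfl⟩

theorem SameInvariants.symm {a b : Fin n → K} (h : SameInvariants a b) : SameInvariants b a := by
  obtain ⟨⟨s, hs, h⟩, h'⟩ := h
  refine ⟨⟨s⁻¹, inv_ne_zero hs, ?_⟩, h'.symm⟩
  rw [h]
  field_simp

theorem SameInvariants.trans {a b c : Fin n → K} (h : SameInvariants a b)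
    (h' : SameInvariants b c) : SameInvariants a c := by
  obtain ⟨⟨s, hs, h₁⟩, h₂⟩ := h
  obtain ⟨⟨t, ht, h₃⟩, h₄⟩ := h'
  exact ⟨⟨s * t, mul_ne_zero hs ht, by rw [h₁, h₃]; ring⟩, h₂.trans h₄⟩

theorem forall_cons_ne_zero {c : K} {a : Fin n → K} (hc : c ≠ 0) (ha : ∀ i, a i ≠ 0) :
    ∀ i, (Fin.cons c a : Fin (n + 1) → K) i ≠ 0 :=
  Fin.cases hc ha

theorem exists_eq_cons {a : Fin (n + 1) → K} (ha : ∀ i, a i ≠ 0) :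
    ∃ (c : K) (l : Fin n → K), c ≠ 0 ∧ (∀ i, l i ≠ 0) ∧ a = Fin.cons c l :=
  ⟨a 0, Fin.tail a, ha 0, fun i => ha i.succ, (Fin.cons_self_tail a).symm⟩

theorem prod_ne_zero_of_forall {a : Fin n → K} (ha : ∀ i, a i ≠ 0) : ∏ i, a i ≠ 0 :=
  Finset.prod_ne_zero_iff.2 fun i _ => ha i

theorem prod_cons (c : K) (a : Fin n → K) :
    ∏ i, (Fin.cons c a : Fin (n + 1) → K) i = c * ∏ i, a i := by
  simp [Fin.prod_univ_succ]

variable (hK : LocalSquareClasses K)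
include hK

theorem LocalSquareClasses.hilbertSym_prod {c : K} (hc : c ≠ 0) {a : Fin n → K}
    (ha : ∀ i, a i ≠ 0) : hilbertSym K c (∏ i, a i) = ∏ i, hilbertSym K c (a i) := by
  induction n with
  | zero =>
    simpa [hilbertSym_comm c] using hK.hilbertSym_of_isSquare one_ne_zero ⟨1, by simp⟩ c
  | succ n ih =>
    rw [Fin.prod_univ_succ, Fin.prod_univ_succ, hK.hilbertSym_mul hc (ha 0)
      (prod_ne_zero_of_forall fun i => ha i.succ), ih fun i => ha i.succ]

theorem LocalSquareClasses.hasseInv_cons {c : K} (hc : c ≠ 0) {a : Fin n → K}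
    (ha : ∀ i, a i ≠ 0) :
    hasseInv K (Fin.cons c a : Fin (n + 1) → K) = hilbertSym K c (∏ i, a i) * hasseInv K a := by
  rw [hK.hilbertSym_prod hc ha]
  simp [hasseInv, Fin.prod_univ_succ]

theorem LocalSquareClasses.sameInvariants_cons {c : K} (hc : c ≠ 0) {a b : Fin n → K}
    (ha : ∀ i, a i ≠ 0) (hb : ∀ i, b i ≠ 0) (h : SameInvariants a b) :
    SameInvariants (Fin.cons c a : Fin (n + 1) → K) (Fin.cons c b : Fin (n + 1) → K) := by
  obtain ⟨⟨s, hs, h⟩, h'⟩ := h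
  refine ⟨⟨s, hs, ?_⟩, ?_⟩
  · rw [prod_cons, prod_cons, h]
    ring
  · rw [hK.hasseInv_cons hc ha, hK.hasseInv_cons hc hb, h',
      hK.hilbertSym_congr_right hc (prod_ne_zero_of_forall hb) hs h]

theorem LocalSquareClasses.sameInvariants_of_cons {c : K} (hc : c ≠ 0) {a b : Fin n → K}
    (ha : ∀ i, a i ≠ 0) (hb : ∀ i, b i ≠ 0)
    (h : SameInvariants (Fin.cons c a : Fin (n + 1) → K) (Fin.cons c b : Fin (n + 1) → K)) :
    SameInvariants a b := by
  obtain ⟨⟨s, hs, h⟩, h'⟩ := h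
  rw [prod_cons, prod_cons, mul_left_comm] at h
  have h := mul_left_cancel₀ hc h
  refine ⟨⟨s, hs, h⟩, ?_⟩
  rw [hK.hasseInv_cons hc ha, hK.hasseInv_cons hc hb,
    hK.hilbertSym_congr_right hc (prod_ne_zero_of_forall hb) hs h] at h'
  rcases hilbertSym_eq_one_or c (∏ i, b i) with h0 | h0 <;> simpa [h0] using h'

theorem LocalSquareClasses.sameInvariants_cons_mul_sq {c s : K} (hc : c ≠ 0) (hs : s ≠ 0)
    {a : Fin n → K} (ha : ∀ i, a i ≠ 0) :
    SameInvariants (Fin.cons c a : Fin (n + 1) → K)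
      (Fin.cons (c * s ^ 2) a : Fin (n + 1) → K) := by
  refine ⟨⟨s⁻¹, inv_ne_zero hs, ?_⟩, ?_⟩
  · rw [prod_cons, prod_cons]
    field_simp
  · rw [hK.hasseInv_cons hc ha, hK.hasseInv_cons (mul_ne_zero hc (pow_ne_zero 2 hs)) ha,
      hilbertSym_comm, hilbertSym_comm (c * s ^ 2),
      hK.hilbertSym_congr_right (prod_ne_zero_of_forall ha) hc hs (mul_comm _ _)]

theorem LocalSquareClasses.sameInvariants_cons_cons {a b c x y : K} (ha : a ≠ 0) (hb : b ≠ 0)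
    (hc : c ≠ 0) (h : c = a * x ^ 2 + b * y ^ 2) {l : Fin n → K} (hl : ∀ i, l i ≠ 0) :
    SameInvariants (Fin.cons a (Fin.cons b l : Fin (n + 1) → K) : Fin (n + 2) → K)
      (Fin.cons c (Fin.cons (a * b * c) l : Fin (n + 1) → K) : Fin (n + 2) → K) := by
  have hab := mul_ne_zero ha hb
  have habc := mul_ne_zero hab hc
  refine ⟨⟨c⁻¹, inv_ne_zero hc, ?_⟩, ?_⟩
  · simp only [prod_cons]
    field_simp
  · have hP := prod_ne_zero_of_forall hl
    have h1 := (hK.exists_eq_add_iff ha hb hc).1 ⟨x, y, h⟩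
    have h2 : hilbertSym K c (a * b * c) = hilbertSym K a b := by
      rw [show a * b * c = -(a * b) * -c by ring,
        hK.hilbertSym_mul hc (neg_ne_zero.2 hab) (neg_ne_zero.2 hc), hK.hilbertSym_self_neg hc, h1,
        mul_one]
    rw [hK.hasseInv_cons ha (forall_cons_ne_zero hb hl),
      hK.hasseInv_cons hc (forall_cons_ne_zero habc hl), hK.hasseInv_cons hb hl,
      hK.hasseInv_cons habc hl, prod_cons, prod_cons, hK.hilbertSym_mul ha hb hP,
      hK.hilbertSym_mul hc habc hP, h2, hK.mul_hilbertSym hab hc hP, hK.mul_hilbertSym ha hb hP]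
    linear_combination -(hilbertSym K a b * hilbertSym K a (∏ i, l i) *
      hilbertSym K b (∏ i, l i) * hasseInv K l) * hilbertSym_mul_self c (∏ i, l i)

/-- A diagonal form representing `c` is equivalent, by moves which preserve the invariants, to a
diagonal form starting with `c`. -/
theorem LocalSquareClasses.exists_equivalent_cons {a : Fin (n + 1) → K} (ha : ∀ i, a i ≠ 0)
    {c : K} (hc : c ≠ 0) {v : Fin (n + 1) → K} (hv : weightedSumSquares K a v = c) :
    ∃ a' : Fin n → K, (∀ i, a' i ≠ 0) ∧
      (weightedSumSquares K a).Equivalent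
        (weightedSumSquares K (Fin.cons c a' : Fin (n + 1) → K)) ∧
      SameInvariants a (Fin.cons c a' : Fin (n + 1) → K) := by
  induction n generalizing c with
  | zero =>
    obtain ⟨a₀, l, ha₀, hl, rfl⟩ := exists_eq_cons ha
    have hv : c = a₀ * v 0 ^ 2 := by
      rw [← hv, weightedSumSquares_cons]
      simp [weightedSumSquares_apply]
    have hv0 : v 0 ≠ 0 := by
      intro h
      simp [h] at hv
      exact hc hv
    subst hv
    exact ⟨l, hl, equivalent_cons_mul_sq l a₀ hv0, hK.sameInvariants_cons_mul_sq ha₀ hv0 hl⟩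
  | succ n ih =>
    obtain ⟨a₀, l, ha₀, hl, rfl⟩ := exists_eq_cons ha
    rw [weightedSumSquares_cons] at hv
    by_cases hd : weightedSumSquares K l (Fin.tail v) = 0
    · rw [hd, add_zero] at hv
      have hv0 : v 0 ≠ 0 := by
        intro h
        simp [h] at hv
        exact hc hv.symm
      subst hv
      exact ⟨l, hl, equivalent_cons_mul_sq l a₀ hv0, hK.sameInvariants_cons_mul_sq ha₀ hv0 hl⟩
    · obtain ⟨l', hl', he, hi⟩ := ih hl hd rfl
      set d := weightedSumSquares K l (Fin.tail v)
      have h : c = a₀ * v 0 ^ 2 + d * 1 ^ 2 := by rw [← hv]; ring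
      refine ⟨Fin.cons (a₀ * d * c) l',
        forall_cons_ne_zero (mul_ne_zero (mul_ne_zero ha₀ hd) hc) hl', ?_, ?_⟩
      · exact (he.cons a₀).trans (equivalent_cons_cons l' hc h)
      · exact (hK.sameInvariants_cons ha₀ hl (forall_cons_ne_zero hd hl') hi).trans
          (hK.sameInvariants_cons_cons ha₀ hd hc h hl')

theorem LocalSquareClasses.sameInvariants_of_equivalent {a b : Fin n → K} (ha : ∀ i, a i ≠ 0)
    (hb : ∀ i, b i ≠ 0) (h : (weightedSumSquares K a).Equivalent (weightedSumSquares K b)) :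
    SameInvariants a b := by
  induction n with
  | zero =>
    rw [Subsingleton.elim a b]
    exact SameInvariants.refl b
  | succ n ih =>
    obtain ⟨c, l, hc, hl, rfl⟩ := exists_eq_cons hb
    obtain ⟨e⟩ := id h
    obtain ⟨a', ha', he, hi⟩ := hK.exists_equivalent_cons ha hc
      (v := e.symm (Fin.cons 1 0 : Fin (n + 1) → K)) (by
        rw [e.symm.map_app, weightedSumSquares_cons]
        simp)
    exact hi.trans (hK.sameInvariants_cons hc ha' hl
      (ih ha' hl ((he.symm.trans h).of_cons hK.two_ne_zero hc)))

/-- Induction step of the classification: two forms representing a common nonzero value. -/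
theorem LocalSquareClasses.equivalent_of_represents
    (ih : ∀ a b : Fin n → K, (∀ i, a i ≠ 0) → (∀ i, b i ≠ 0) → SameInvariants a b →
      (weightedSumSquares K a).Equivalent (weightedSumSquares K b))
    {a b : Fin (n + 1) → K} (ha : ∀ i, a i ≠ 0) (hb : ∀ i, b i ≠ 0) (h : SameInvariants a b)
    {c : K} (hc : c ≠ 0) {v w : Fin (n + 1) → K} (hv : weightedSumSquares K a v = c)
    (hw : weightedSumSquares K b w = c) :
    (weightedSumSquares K a).Equivalent (weightedSumSquares K b) := by
  obtain ⟨a', ha', hea, hia⟩ := hK.exists_equivalent_cons ha hc hv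
  obtain ⟨b', hb', heb, hib⟩ := hK.exists_equivalent_cons hb hc hw
  have hi := hK.sameInvariants_of_cons hc ha' hb' ((hia.symm.trans h).trans hib)
  exact (hea.trans ((ih a' b' ha' hb' hi).cons c)).trans heb.symm

theorem LocalSquareClasses.exists_weightedSumSquares_eq {a : Fin (n + 3) → K}
    (ha : ∀ i, a i ≠ 0) {c : K} (hc : c ≠ 0) (hsq : ¬ IsSquare (-(a 0 * a 1 * a 2) * c)) :
    ∃ v, weightedSumSquares K a v = c := by
  obtain ⟨x, y, z, h⟩ := hK.exists_eq_add_add (ha 0) (ha 1) (ha 2) hc hsq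
  refine ⟨Fin.cons x (Fin.cons y (Fin.cons z 0 : Fin (n + 1) → K) : Fin (n + 2) → K), ?_⟩
  rw [h]
  simp [weightedSumSquares_apply, Fin.sum_univ_succ]
  ring

theorem LocalSquareClasses.equivalent_of_sameInvariants {a b : Fin n → K} (ha : ∀ i, a i ≠ 0)
    (hb : ∀ i, b i ≠ 0) (h : SameInvariants a b) :
    (weightedSumSquares K a).Equivalent (weightedSumSquares K b) := by
  induction n with
  | zero =>
    rw [Subsingleton.elim a b]
  | succ n ih =>
    have step := fun {c : K} => hK.equivalent_of_represents
      (fun a b ha hb h => ih ha hb h) ha hb h (c := c)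
    match n with
    | 0 =>
      obtain ⟨s, hs, hd⟩ := h.disc
      refine step (ha 0) (v := fun _ => 1) (w := fun _ => s) ?_ ?_
      · simp [weightedSumSquares_apply]
      · simp at hd
        simp [weightedSumSquares_apply, hd]
        ring
    | 1 =>
      obtain ⟨⟨s, hs, hd⟩, hh⟩ := h
      have hb0 := mul_ne_zero (hb 0) (hb 1)
      change ∏ i : Fin 2, a i = s ^ 2 * ∏ i : Fin 2, b i at hd
      change hasseInv K (n := 2) a = hasseInv K (n := 2) b at hh
      simp only [Fin.prod_univ_two] at hd
      simp only [hasseInv, Fin.prod_univ_two] at hh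
      simp at hh
      have h1 := (hK.exists_eq_add_iff (hb 0) (hb 1) (hb 0)).1 ⟨1, 0, by ring⟩
      obtain ⟨x, y, hxy⟩ := (hK.exists_eq_add_iff (ha 0) (ha 1) (hb 0)).2 (by
        rw [hh, ← h1, hK.hilbertSym_congr_right (hb 0) (neg_ne_zero.2 hb0) hs]
        rw [hd]
        ring)
      refine step (hb 0) (v := ![x, y]) (w := ![1, 0]) ?_ ?_
      · rw [hxy]
        simp [weightedSumSquares_apply, Fin.sum_univ_two]
        ring
      · simp [weightedSumSquares_apply, Fin.sum_univ_two]
    | n + 2 =>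
      have aux : ∀ {d : Fin (n + 3) → K}, (∀ i, d i ≠ 0) → -(d 0 * d 1 * d 2) ≠ 0 := fun hd =>
        neg_ne_zero.2 (mul_ne_zero (mul_ne_zero (hd 0) (hd 1)) (hd 2))
      obtain ⟨c, hc, h1, h2⟩ := hK.exists_common (aux ha) (aux hb)
      obtain ⟨v, hv⟩ := hK.exists_weightedSumSquares_eq ha hc h1
      obtain ⟨w, hw⟩ := hK.exists_weightedSumSquares_eq hb hc h2
      exact step hc hv hw

end Classification

theorem Padic.localSquareClasses (p : ℕ) [Fact p.Prime] : LocalSquareClasses ℚ_[p] :=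
  ⟨two_ne_zero, fun _ => Padic.quadNormIndexTwo, Padic.exists_square_classes⟩

/-- Two non-degenerate quadratic forms over `ℚ` of the same rank,
diagonalized as `⟨a i⟩` and `⟨b i⟩`, become isomorphic over `ℚ_p` if and only if
their discriminants coincide in `ℚ_p^×/(ℚ_p^×)²` and their Hasse invariants at `p`
coincide. -/
theorem equivalent_over_Qp_iff {n : ℕ} (a b : Fin n → ℚ) (ha : ∀ i, a i ≠ 0)
    (hb : ∀ i, b i ≠ 0) (p : ℕ) [Fact p.Prime] :
    (QuadraticMap.weightedSumSquares ℚ_[p] fun i => (a i : ℚ_[p])).Equivalent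
        (QuadraticMap.weightedSumSquares ℚ_[p] fun i => (b i : ℚ_[p])) ↔
      (∃ c : ℚ_[p], c ≠ 0 ∧ (∏ i, (a i : ℚ_[p])) = c ^ 2 * ∏ i, (b i : ℚ_[p])) ∧
        hasseInv ℚ_[p] (fun i => (a i : ℚ_[p])) = hasseInv ℚ_[p] (fun i => (b i : ℚ_[p])) := by
  have hK := Padic.localSquareClasses p
  have ha' : ∀ i, (a i : ℚ_[p]) ≠ 0 := fun i => Rat.cast_ne_zero.2 (ha i)
  have hb' : ∀ i, (b i : ℚ_[p]) ≠ 0 := fun i => Rat.cast_ne_zero.2 (hb i)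
  refine ⟨fun h => ?_, fun h => hK.equivalent_of_sameInvariants ha' hb' ⟨h.1, h.2⟩⟩
  have := hK.sameInvariants_of_equivalent ha' hb' h
  exact ⟨this.disc, this.hasse⟩

end
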